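/- arXiv:2503.14707 — 2 statements merged into one kernel-verified Lean document; each statement's English description precedes it below -/
import Mathlib

section
/- Let O be a linear order on a finite set C of parties, let sw : C × C → ℝ≥0 assign nonnegative swap prices, and let c ∈ C. Define the swap cost of a linear order Ô relative to O as the sum of sw(x,y) over all inverted pairs (x,y) of (O,Ô). Then the minimum swap cost over all linear orders Ô in which c is ranked first equals Σ_{x above c in O} sw(x,c), and this minimum is attained by the order that moves c to the first position and leaves the relative order of all other parties unchanged. -/
open Finset

namespace Stmt9

/-- The inverted pairs of `(O, Ob)`: pairs `(x, y)` with `y` below `x` in `O`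
and `y` above `x` in `Ob`. -/
def invPairs {C : Type*} [Fintype C] [DecidableEq C]
    (O Ob : C ≃ Fin (Fintype.card C)) : Finset (C × C) :=
  (Finset.univ : Finset (C × C)).filter fun q => O q.1 < O q.2 ∧ Ob q.2 < Ob q.1

/-- The pairs `(x, c)` with `x` above `c` in `O`. -/
def abovePairs {C : Type*} [Fintype C] [DecidableEq C]
    (O : C ≃ Fin (Fintype.card C)) (c : C) : Finset (C × C) :=
  (Finset.univ.filter fun x => O x < O c).image fun x => (x, c)

theorem sum_abovePairs {C : Type*} [Fintype C] [DecidableEq C]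
    (O : C ≃ Fin (Fintype.card C)) (sw : C → C → ℝ) (c : C) :
    ∑ q ∈ abovePairs O c, sw q.1 q.2 =
      ∑ x ∈ Finset.univ.filter (fun x => O x < O c), sw x c :=
  Finset.sum_image fun _ _ _ _ h => congrArg Prod.fst h

theorem lt_of_val_eq_zero {C : Type*} [Fintype C] {Ob : C ≃ Fin (Fintype.card C)} {c x : C}
    (h0 : (Ob c).val = 0) (hx : x ≠ c) : Ob c < Ob x := by
  have hne : (Ob x).val ≠ (Ob c).val := fun h => hx (Ob.injective (Fin.ext h))
  exact Fin.lt_def.2 (by omega)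

theorem abovePairs_subset_invPairs {C : Type*} [Fintype C] [DecidableEq C]
    (O : C ≃ Fin (Fintype.card C)) {Ob : C ≃ Fin (Fintype.card C)} {c : C}
    (h0 : (Ob c).val = 0) : abovePairs O c ⊆ invPairs O Ob := by
  intro q hq
  simp only [abovePairs, mem_image, mem_filter, mem_univ, true_and] at hq
  obtain ⟨x, hx, rfl⟩ := hq
  have hxc : x ≠ c := fun h => by simp [h] at hx
  simpa [invPairs] using And.intro hx (lt_of_val_eq_zero h0 hxc)

theorem invPairs_eq_abovePairs {C : Type*} [Fintype C] [DecidableEq C]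
    {O Ob : C ≃ Fin (Fintype.card C)} {c : C} (h0 : (Ob c).val = 0)
    (h : ∀ x y : C, x ≠ c → y ≠ c → (O x < O y ↔ Ob x < Ob y)) :
    invPairs O Ob = abovePairs O c := by
  refine Subset.antisymm ?_ (abovePairs_subset_invPairs O h0)
  rintro ⟨x, y⟩ hq
  simp only [invPairs, mem_filter, mem_univ, true_and] at hq
  obtain ⟨hO, hOb⟩ := hq
  have hx : x ≠ c := by
    rintro rfl
    exact absurd (Fin.lt_def.1 hOb) (by omega)
  have hy : y = c := by
    by_contra hy
    exact lt_asymm hOb ((h x y hx hy).1 hO)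
  subst hy
  simpa [abovePairs] using hO

/-- Moving `c` to the first position while keeping all other relative orders is possible. -/
theorem exists_moveToFirst {C : Type*} [Fintype C]
    (O : C ≃ Fin (Fintype.card C)) (c : C) :
    ∃ Ob : C ≃ Fin (Fintype.card C), (Ob c).val = 0 ∧
      ∀ x y : C, x ≠ c → y ≠ c → (O x < O y ↔ Ob x < Ob y) := by
  have : NeZero (Fintype.card C) := ⟨(Fintype.card_pos_iff.2 ⟨c⟩).ne'⟩
  have hval : ∀ x : C, x ≠ c →
      ((O c).cycleRange (O x)).val = if O x < O c then (O x).val + 1 else (O x).val := by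
    intro x hx
    split_ifs with hlt
    · exact Fin.coe_cycleRange_of_lt hlt
    · have hne : O x ≠ O c := fun h => hx (O.injective h)
      rw [Fin.cycleRange_of_gt (lt_of_le_of_ne (not_lt.1 hlt) hne.symm)]
  refine ⟨O.trans (O c).cycleRange, by simp [Fin.cycleRange_self], fun x y hx hy => ?_⟩
  have hxc : (O x).val ≠ (O c).val := fun h => hx (O.injective (Fin.ext h))
  have hyc : (O y).val ≠ (O c).val := fun h => hy (O.injective (Fin.ext h))
  simp only [Equiv.trans_apply, Fin.lt_def, hval x hx, hval y hy]
  split_ifs <;> omega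

/-- the minimum swap cost over all orders ranking `c` first equals
`Σ_{x above c in O} sw(x,c)`, and it is attained by the order that moves `c` to the
first position leaving the relative order of all other parties unchanged. -/
theorem stmt_9 {C : Type*} [Fintype C] [DecidableEq C]
    (O : C ≃ Fin (Fintype.card C)) (sw : C → C → ℝ) (hsw : ∀ x y, 0 ≤ sw x y) (c : C) :
    IsLeast
      { B : ℝ | ∃ Ob : C ≃ Fin (Fintype.card C), (Ob c).val = 0 ∧
          B = ∑ q ∈ invPairs O Ob, sw q.1 q.2 }
      (∑ x ∈ Finset.univ.filter (fun x => O x < O c), sw x c) ∧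
    (∀ Ob : C ≃ Fin (Fintype.card C), (Ob c).val = 0 →
      (∀ x y : C, x ≠ c → y ≠ c → (O x < O y ↔ Ob x < Ob y)) →
      (∑ q ∈ invPairs O Ob, sw q.1 q.2) =
        ∑ x ∈ Finset.univ.filter (fun x => O x < O c), sw x c) := by
  have hmin : ∀ Ob : C ≃ Fin (Fintype.card C), (Ob c).val = 0 →
      (∀ x y : C, x ≠ c → y ≠ c → (O x < O y ↔ Ob x < Ob y)) →
      (∑ q ∈ invPairs O Ob, sw q.1 q.2) =
        ∑ x ∈ Finset.univ.filter (fun x => O x < O c), sw x c := by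
    intro Ob h0 h
    rw [invPairs_eq_abovePairs h0 h, sum_abovePairs]
  refine ⟨⟨?_, ?_⟩, hmin⟩
  · obtain ⟨Ob, h0, h⟩ := exists_moveToFirst O c
    exact ⟨Ob, h0, (hmin Ob h0 h).symm⟩
  · rintro B ⟨Ob, h0, rfl⟩
    rw [← sum_abovePairs]
    exact Finset.sum_le_sum_of_subset_of_nonneg (abovePairs_subset_invPairs O h0)
      fun q _ _ => hsw q.1 q.2

end Stmt9
end

section
/- Let O be a linear order on a finite set C of m parties, let c_1 ∈ C with pos(O,c_1) = m − k_1, and let S ⊆ C∖{c_1} be a set of ℓ parties all ranked below c_1 in O. Consider the linear orders Ô on C satisfying: every member of S is below c_1 in Ô; the relative order of the parties of C∖S in Ô is the same as in O; the relative order of the parties of S in Ô is the same as in O; and every inverted pair (x,y) of (O,Ô) has y ∈ S. Then the set of pairs (number of inverted pairs of (O,Ô), Borda(Ô,S)) over all such Ô is exactly {(t, Borda(O,S) + t) : t ∈ ℤ, 0 ≤ t ≤ T̄}, where T̄ = (ℓ·k_1 − ℓ(ℓ+1)/2) − Borda(O,S). -/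
open Finset

namespace Stmt15

/-- The Borda score of party `c` under the linear order `O`:
`Borda(O,c) = m − pos(O,c)`, where `pos(O,c) = (O c).val + 1`. -/
def borda {C : Type*} [Fintype C] (O : C ≃ Fin (Fintype.card C)) (c : C) : ℕ :=
  Fintype.card C - 1 - (O c).val

/-- The total Borda score of a set `S` of parties. -/
def bordaSum {C : Type*} [Fintype C] (O : C ≃ Fin (Fintype.card C)) (S : Finset C) : ℕ :=
  ∑ c ∈ S, borda O c

/-- The inverted pairs of `(O, Ob)`: pairs `(x, y)` with `y` below `x` in `O`
and `y` above `x` in `Ob`. -/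
def invPairs {C : Type*} [Fintype C] [DecidableEq C]
    (O Ob : C ≃ Fin (Fintype.card C)) : Finset (C × C) :=
  (Finset.univ : Finset (C × C)).filter fun q => O q.1 < O q.2 ∧ Ob q.2 < Ob q.1

theorem sum_range_le_sum_of_succ_mem {V : Finset ℤ} {k : ℤ}
    (hsucc : ∀ v ∈ V, v + 1 ∈ V ∨ v + 1 = k) :
    ∑ n ∈ range #V, (k - #V + n) ≤ ∑ v ∈ V, v := by
  refine Finset.sum_range_le_sum fun v hv => ?_
  have hsub : Finset.Ico v k ⊆ V := by
    intro w hw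
    rw [Finset.mem_Ico] at hw
    obtain ⟨hvw, hwk⟩ := hw
    induction w, hvw using Int.leInduction with
    | base => exact hv
    | succ w _ ih =>
      rcases hsucc w (ih (by lia)) with h | h
      · exact h
      · lia
  have hcard := Finset.card_le_card hsub
  rw [Int.card_Ico] at hcard
  lia

theorem sum_range_natCast (n : ℕ) : ∑ i ∈ range n, (i : ℤ) = n * (n + 1) / 2 - n := by
  have h : (∑ i ∈ range n, (i : ℤ)) * 2 + 2 * n = n * (n + 1) := by
    induction n with
    | zero => simp
    | succ n ih => rw [Finset.sum_range_succ]; push_cast; linarith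
  lia

section

variable {C : Type*} [Fintype C]

/-- `Ob` is obtained from `O` by moving members of `S` up, never past `c1`, without changing the
relative order inside `S` or inside its complement. -/
structure IsPromotion (O : C ≃ Fin (Fintype.card C)) (c1 : C) (S : Finset C)
    (Ob : C ≃ Fin (Fintype.card C)) : Prop where
  below : ∀ c ∈ S, Ob c1 < Ob c
  compl_iff : ∀ x ∉ S, ∀ y ∉ S, (O x < O y ↔ Ob x < Ob y)
  mem_iff : ∀ x ∈ S, ∀ y ∈ S, (O x < O y ↔ Ob x < Ob y)
  mem_of_inverted : ∀ x y : C, O x < O y → Ob y < Ob x → y ∈ S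

theorem borda_eq_card_filter (O : C ≃ Fin (Fintype.card C)) (c : C) :
    borda O c = #{x | O c < O x} := by
  have h : #{x | O c < O x} = #(Finset.Ioi (O c)) := by
    rw [← Finset.card_map O.toEmbedding]
    congr 1
    ext i
    simp only [Finset.mem_map_equiv, Finset.mem_filter, Finset.mem_univ, true_and,
      Finset.mem_Ioi, Equiv.apply_symm_apply]
  rw [h, Fin.card_Ioi, borda]

theorem borda_intCast (O : C ≃ Fin (Fintype.card C)) (c : C) :
    (borda O c : ℤ) = Fintype.card C - 1 - (O c).val := by
  have := (O c).isLt
  unfold borda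
  lia

theorem borda_intCast_injective (O : C ≃ Fin (Fintype.card C)) :
    Function.Injective fun c => (borda O c : ℤ) := by
  intro x y h
  simp only [borda_intCast] at h
  exact O.injective (Fin.ext (by lia))

theorem bordaSum_intCast (O : C ≃ Fin (Fintype.card C)) (S : Finset C) :
    (bordaSum O S : ℤ) = ∑ v ∈ S.image fun c => (borda O c : ℤ), v := by
  rw [Finset.sum_image (borda_intCast_injective O).injOn, bordaSum, Nat.cast_sum]

variable {O Ob : C ≃ Fin (Fintype.card C)} {c1 : C} {S : Finset C}

theorem isPromotion_refl (hO : ∀ c ∈ S, O c1 < O c) : IsPromotion O c1 S O :=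
  ⟨hO, fun _ _ _ _ => Iff.rfl, fun _ _ _ _ => Iff.rfl, fun _ _ h h' => absurd h h'.not_gt⟩

/-- The members of `S` are all below `c1`, so their scores are distinct and below that of `c1`. -/
theorem bordaSum_le (hS : ∀ c ∈ S, Ob c1 < Ob c) :
    (bordaSum Ob S : ℤ) ≤ #S * borda Ob c1 - #S * (#S + 1) / 2 := by
  have h := Finset.sum_le_sum_range (s := S.image fun c => (borda Ob c : ℤ))
    (c := borda Ob c1 - 1) (by
      simp only [Finset.forall_mem_image, borda_intCast]
      intro c hc
      have := Fin.lt_def.1 (hS c hc)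
      lia)
  rw [← bordaSum_intCast, Finset.card_image_of_injective _ (borda_intCast_injective Ob),
    Finset.sum_sub_distrib, sum_range_natCast] at h
  simp only [Finset.sum_const, Finset.card_range, nsmul_eq_mul] at h
  linarith

variable [DecidableEq C]

theorem IsPromotion.bordaSum_eq (h : IsPromotion O c1 S Ob) :
    bordaSum Ob S = bordaSum O S + #(invPairs O Ob) := by
  have hinv : #(invPairs O Ob) = ∑ y ∈ S, #{x | O x < O y ∧ Ob y < Ob x} := by
    rw [Finset.card_eq_sum_card_fiberwise (f := Prod.snd) (t := S)]
    · refine Finset.sum_congr rfl fun y _ => ?_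
      refine Finset.card_bij' (fun q _ => q.1) (fun x _ => (x, y)) ?_ ?_ ?_ ?_
      all_goals simp +contextual [invPairs]
      · rintro a b h1 h2 rfl; exact ⟨h1, h2⟩
    · intro q hq
      simp only [invPairs, Finset.coe_filter, Finset.mem_univ, true_and, Set.mem_ofPred_eq] at hq
      exact h.mem_of_inverted _ _ hq.1 hq.2
  rw [hinv, bordaSum, bordaSum, ← Finset.sum_add_distrib]
  refine Finset.sum_congr rfl fun y hy => ?_
  rw [borda_eq_card_filter, borda_eq_card_filter, ← Finset.card_union_of_disjoint]
  · congr 1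
    ext x
    simp only [Finset.mem_filter, Finset.mem_univ, true_and, Finset.mem_union]
    have h1 := h.mem_of_inverted y x
    have h2 := h.mem_iff y hy x
    have h3 : O x = O y → x = y := fun e => O.injective e
    have h4 : Ob x = Ob y → x = y := fun e => Ob.injective e
    grind
  · rw [Finset.disjoint_filter]
    intro x _ h1 h2
    exact absurd h2.1 h1.not_gt

theorem IsPromotion.apply_eq (hO : ∀ c ∈ S, O c1 < O c) (hc : c1 ∉ S)
    (h : IsPromotion O c1 S Ob) : Ob c1 = O c1 := by
  have hb : borda Ob c1 = borda O c1 := by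
    rw [borda_eq_card_filter, borda_eq_card_filter]
    congr 1
    ext x
    simp only [Finset.mem_filter, Finset.mem_univ, true_and]
    by_cases hx : x ∈ S
    · simp [hO x hx, h.below x hx]
    · exact (h.compl_iff c1 hc x hx).symm
  unfold borda at hb
  ext
  omega

theorem IsPromotion.swap (h : IsPromotion O c1 S Ob) {x y : C} (hx : x ∉ S) (hxc : x ≠ c1)
    (hc : c1 ∉ S) (hy : y ∈ S) (hxy : (Ob x).val + 1 = (Ob y).val) :
    IsPromotion O c1 S ((Equiv.swap x y).trans Ob) := by
  have hlt : ∀ a b, ¬ (a = x ∧ b = y) → ¬ (a = y ∧ b = x) →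
      ((Equiv.swap x y).trans Ob a < (Equiv.swap x y).trans Ob b ↔ Ob a < Ob b) := by
    intro a b h1 h2
    have e : ∀ u v, (Ob u).val = (Ob v).val → u = v := fun u v e => Ob.injective (Fin.ext e)
    have := e a x
    have := e a y
    have := e b x
    have := e b y
    simp only [Equiv.trans_apply, Equiv.swap_apply_def, Fin.lt_def]
    grind
  have hne : ∀ a ∈ S, a ≠ x := fun a ha e => hx (e ▸ ha)
  have hne' : ∀ a ∉ S, a ≠ y := fun a ha e => ha (e ▸ hy)
  refine ⟨fun c hcS => ?_, fun a ha b hb => ?_, fun a ha b hb => ?_, fun a b hab hba => ?_⟩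
  · rw [hlt _ _ (fun e => hxc e.1.symm) (fun e => hne' _ hc e.1)]
    exact h.below c hcS
  · rw [hlt _ _ (fun e => hne' _ hb e.2) (fun e => hne' _ ha e.1)]
    exact h.compl_iff a ha b hb
  · rw [hlt _ _ (fun e => hne _ ha e.1) (fun e => hne _ hb e.2)]
    exact h.mem_iff a ha b hb
  · by_cases h1 : b = y
    · exact h1 ▸ hy
    by_cases h2 : b = x ∧ a = y
    · obtain ⟨rfl, rfl⟩ := h2
      have : Ob b < Ob a := by rw [Fin.lt_def]; omega
      exact absurd hba (by simpa using this.not_gt)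
    rw [hlt _ _ h2 (fun e => h1 e.1)] at hba
    exact h.mem_of_inverted a b hab hba

theorem bordaSum_swap {x y : C} (hx : x ∉ S) (hy : y ∈ S)
    (hxy : (Ob x).val + 1 = (Ob y).val) :
    bordaSum ((Equiv.swap x y).trans Ob) S = bordaSum Ob S + 1 := by
  unfold bordaSum
  rw [← Finset.add_sum_erase _ _ hy, ← Finset.add_sum_erase _ _ hy]
  have h1 : ∑ c ∈ S.erase y, borda ((Equiv.swap x y).trans Ob) c =
      ∑ c ∈ S.erase y, borda Ob c := by
    refine Finset.sum_congr rfl fun c hc => ?_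
    rw [Finset.mem_erase] at hc
    simp only [borda, Equiv.trans_apply]
    rw [Equiv.swap_apply_of_ne_of_ne (ne_of_mem_of_not_mem hc.2 hx) hc.1]
  rw [h1]
  simp only [borda, Equiv.trans_apply, Equiv.swap_apply_right]
  have := (Ob y).isLt
  omega

/-- Below the maximal score, some member of `S` is directly preceded by a party other than `c1`
outside `S`. -/
theorem exists_swappable (hS : ∀ c ∈ S, Ob c1 < Ob c)
    (hlt : (bordaSum Ob S : ℤ) < #S * borda Ob c1 - #S * (#S + 1) / 2) :
    ∃ x ∉ S, ∃ y ∈ S, x ≠ c1 ∧ (Ob x).val + 1 = (Ob y).val := by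
  by_contra! hno
  have h := sum_range_le_sum_of_succ_mem (V := S.image fun c => (borda Ob c : ℤ))
    (k := borda Ob c1) (by
      simp only [Finset.forall_mem_image]
      intro y hy
      have hy1 := Fin.lt_def.1 (hS y hy)
      obtain ⟨x, hx⟩ := Ob.surjective ⟨(Ob y).val - 1, by lia⟩
      have hxy : (Ob x).val + 1 = (Ob y).val := by rw [hx]; dsimp only; lia
      have hb : (borda Ob y : ℤ) + 1 = borda Ob x := by simp only [borda_intCast]; lia
      rw [hb]
      by_cases hxS : x ∈ S
      · exact Or.inl (Finset.mem_image_of_mem _ hxS)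
      · by_cases hxc : x = c1
        · exact Or.inr (by rw [hxc])
        · exact absurd hxy (hno x hxS y hy hxc))
  rw [← bordaSum_intCast, Finset.card_image_of_injective _ (borda_intCast_injective Ob),
    Finset.sum_add_distrib, sum_range_natCast] at h
  simp only [Finset.sum_const, Finset.card_range, nsmul_eq_mul] at h
  have h2 : (#S * (#S + 1) : ℤ) = 2 * (#S * (#S + 1) / 2) := by
    rw [Int.mul_ediv_cancel' (Int.even_mul_succ_self _).two_dvd]
  linarith

theorem exists_isPromotion_bordaSum_eq (hO : ∀ c ∈ S, O c1 < O c) (hc : c1 ∉ S) (t : ℕ)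
    (ht : (bordaSum O S + t : ℤ) ≤ #S * borda O c1 - #S * (#S + 1) / 2) :
    ∃ Ob, IsPromotion O c1 S Ob ∧ bordaSum Ob S = bordaSum O S + t := by
  induction t with
  | zero => exact ⟨O, isPromotion_refl hO, rfl⟩
  | succ t ih =>
    push_cast at ht
    obtain ⟨Ob, hOb, hsum⟩ := ih (by linarith)
    have hb : borda Ob c1 = borda O c1 := by rw [borda, borda, hOb.apply_eq hO hc]
    obtain ⟨x, hx, y, hy, hxc, hxy⟩ := exists_swappable hOb.below (by
      rw [hb, hsum]; push_cast; linarith)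
    exact ⟨_, hOb.swap hx hxc hc hy hxy, by rw [bordaSum_swap hx hy hxy, hsum]; ring⟩

end

/-- over all `Ob` keeping `S` below `c₁`, keeping the relative order of
`C∖S` and of `S`, and whose inverted pairs only move members of `S` up, the attainable
pairs `(#inverted pairs, Borda(Ob,S))` are exactly `{(t, Borda(O,S)+t) : 0 ≤ t ≤ T̄}`
with `T̄ = (ℓ·k₁ − ℓ(ℓ+1)/2) − Borda(O,S)`. -/
theorem stmt_15 {C : Type*} [Fintype C] [DecidableEq C]
    (O : C ≃ Fin (Fintype.card C)) (c1 : C) (k1 : ℕ)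
    (hpos : (O c1).val + 1 = Fintype.card C - k1)
    (S : Finset C) (hc1S : c1 ∉ S) (ℓ : ℕ) (hS : S.card = ℓ)
    (hbelow : ∀ c ∈ S, O c1 < O c) :
    { p : ℤ × ℤ | ∃ Ob : C ≃ Fin (Fintype.card C),
        (∀ c ∈ S, Ob c1 < Ob c) ∧
        (∀ x ∉ S, ∀ y ∉ S, (O x < O y ↔ Ob x < Ob y)) ∧
        (∀ x ∈ S, ∀ y ∈ S, (O x < O y ↔ Ob x < Ob y)) ∧
        (∀ x y : C, O x < O y → Ob y < Ob x → y ∈ S) ∧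
        p = (((invPairs O Ob).card : ℤ), (bordaSum Ob S : ℤ)) } =
    { p : ℤ × ℤ | ∃ t : ℤ, 0 ≤ t ∧
        t ≤ ((ℓ : ℤ) * (k1 : ℤ) - ((ℓ : ℤ) * ((ℓ : ℤ) + 1)) / 2) - (bordaSum O S : ℤ) ∧
        p = (t, (bordaSum O S : ℤ) + t) } := by
  subst hS
  have hk : (k1 : ℤ) = borda O c1 := by rw [borda_intCast]; lia
  rw [hk]
  ext p
  constructor
  · rintro ⟨Ob, h1, h2, h3, h4, rfl⟩
    have h : IsPromotion O c1 S Ob := ⟨h1, h2, h3, h4⟩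
    have hsum : (bordaSum Ob S : ℤ) = bordaSum O S + #(invPairs O Ob) := by
      exact_mod_cast h.bordaSum_eq
    have hb : borda Ob c1 = borda O c1 := by rw [borda, borda, h.apply_eq hbelow hc1S]
    have hle := bordaSum_le h.below
    rw [hb] at hle
    exact ⟨#(invPairs O Ob), Int.natCast_nonneg _, by linarith, by rw [hsum]⟩
  · rintro ⟨t, ht0, ht, rfl⟩
    lift t to ℕ using ht0
    obtain ⟨Ob, h, hsum⟩ := exists_isPromotion_bordaSum_eq hbelow hc1S t (by linarith)
    have hcard : #(invPairs O Ob) = t := by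
      have := h.bordaSum_eq
      lia
    exact ⟨Ob, h.below, h.compl_iff, h.mem_iff, h.mem_of_inverted, by simp [hcard, hsum]⟩

end Stmt15
end
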